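/- Let f : (ZMod p)^n → ℝ/ℤ be a nonclassical polynomial of degree ≤ d (i.e., all (d+1)-fold additive derivatives vanish). If f(x) = 0 for every x ∈ {0,1}^n of Hamming weight at most d, then f(x) = 0 for every x ∈ {0,1}^n. -/

import Mathlib

open Finset

/-- Additive directional derivative `D_h f(x) = f(x+h) - f(x)`. -/
noncomputable def D {V M : Type*} [Add V] [AddCommGroup M] (h : V) (f : V → M) : V → M :=
  fun x => f (x + h) - f x

/-- `f` is a nonclassical polynomial of degree at most `d`:
all `(d+1)`-fold iterated derivatives vanish identically. -/
def IsNCPoly {V M : Type*} [Add V] [AddCommGroup M] (d : ℕ) (f : V → M) : Prop :=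
  ∀ hs : List V, hs.length = d + 1 → hs.foldr D f = 0

/-- `e(t) = exp(2πit)` on the torus `ℝ/ℤ`. -/
noncomputable def e : AddCircle (1 : ℝ) → ℂ :=
  Function.Periodic.lift (f := fun t : ℝ => Complex.exp (2 * (Real.pi : ℂ) * Complex.I * (t : ℂ)))
    (by
      intro t
      dsimp only
      rw [Complex.ofReal_add, Complex.ofReal_one, mul_add, mul_one, Complex.exp_add,
        Complex.exp_two_pi_mul_I, mul_one])

/-- `x` is a Boolean point: all coordinates are `0` or `1`. -/
def IsBool {n : ℕ} {R : Type*} [Zero R] [One R] (x : Fin n → R) : Prop :=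
  ∀ i, x i = 0 ∨ x i = 1

/-- An iterated derivative along distinct coordinate directions outside `A`, evaluated at the
indicator of `A`, reduces to the top vertex of the cube when `f` vanishes at all the others. -/
theorem foldr_D_single_indicator {ι R M : Type*} [DecidableEq ι] [AddMonoidWithOne R]
    [AddCommGroup M] (f : (ι → R) → M) (L : List ι) (hL : L.Nodup) (A : Finset ι)
    (hA : ∀ i ∈ L, i ∉ A)
    (hf : ∀ S : Finset ι, A ⊆ S → S ⊂ A ∪ L.toFinset → f (fun j => if j ∈ S then 1 else 0) = 0) :
    (L.map fun i => Pi.single i (1 : R)).foldr D f (fun j => if j ∈ A then 1 else 0) =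
      f (fun j => if j ∈ A ∪ L.toFinset then 1 else 0) := by
  induction L generalizing A with
  | nil => simp
  | cons i t ih =>
    obtain ⟨hit, ht⟩ := List.nodup_cons.mp hL
    have hiA : i ∉ A := hA i (by simp)
    have hstep : ((fun j => if j ∈ A then 1 else 0) + Pi.single i 1 : ι → R) =
        fun j => if j ∈ insert i A then 1 else 0 := by
      funext j
      by_cases h : j = i
      · subst h
        simp [hiA]
      · simp [h]
    have hunion : insert i A ∪ t.toFinset = A ∪ (i :: t).toFinset := by
      ext j
      simp only [mem_union, mem_insert, List.mem_toFinset, List.mem_cons]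
      tauto
    have hlt : A ∪ t.toFinset ⊂ A ∪ (i :: t).toFinset := by
      refine Finset.ssubset_iff_subset_ne.mpr ⟨?_, fun h => ?_⟩
      · rw [← hunion]
        exact union_subset_union_left (subset_insert i A)
      · have hi : i ∈ A ∪ t.toFinset := h ▸ (by simp)
        simp [hiA, hit] at hi
    rw [List.map_cons, List.foldr_cons, D, hstep, ih ht (insert i A), ih ht A, hunion,
      hf _ subset_union_left hlt, sub_zero]
    · exact fun j hj => hA j (List.mem_cons_of_mem i hj)
    · exact fun S hAS hS => hf S hAS (hS.trans hlt)
    · intro j hj h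
      rcases mem_insert.mp h with rfl | h
      · exact hit hj
      · exact hA j (List.mem_cons_of_mem i hj) h
    · exact fun S hAS hS => hf S ((subset_insert i A).trans hAS) (hunion ▸ hS)

open scoped Classical in
/-- Interpolation: a nonclassical polynomial of degree `≤ d` vanishing on all
Boolean points of Hamming weight `≤ d` vanishes on all Boolean points. -/
theorem stmt16 (p n d : ℕ) [Fact p.Prime]
    (f : (Fin n → ZMod p) → AddCircle (1 : ℝ))
    (hdeg : IsNCPoly d f)
    (hball : ∀ x : Fin n → ZMod p, IsBool x →
      (Finset.univ.filter fun i => x i ≠ 0).card ≤ d → f x = 0) :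
    ∀ x : Fin n → ZMod p, IsBool x → f x = 0 := by
  have key : ∀ S : Finset (Fin n), f (fun j => if j ∈ S then 1 else 0) = 0 := by
    intro S
    induction S using Finset.strongInduction with
    | H S ih =>
      by_cases hS : S.card ≤ d
      · refine hball _ (fun i => ?_) ?_
        · by_cases h : i ∈ S <;> simp [h]
        · simpa using hS
      · obtain ⟨T, hTS, hT⟩ := exists_subset_card_eq (show d + 1 ≤ S.card by omega)
        have hST : S \ T ∪ T.toList.toFinset = S := by
          rw [toList_toFinset, sdiff_union_of_subset hTS]
        have h := foldr_D_single_indicator f T.toList T.nodup_toList (S \ T)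
          (fun i hi => by simp [mem_toList.mp hi])
          (fun U _ hU => ih U (hST ▸ hU))
        rw [hST, hdeg _ (by simp [hT])] at h
        exact h.symm
  intro x hx
  convert key (univ.filter fun i => x i ≠ 0) using 2
  funext j
  rcases hx j with h | h <;> simp [h]
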